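/- For σ > 0 let T_σ : ℝ → ℝ be the symmetric triangular density of half-width σ, T_σ(z) = (1/σ)(1 − |z|/σ) for |z| ≤ σ and T_σ(z) = 0 otherwise. Then for any μ₁, μ₂ ∈ ℝ with Δ = |μ₁ − μ₂|, the overlap coefficient of the two shifted triangular densities is ∫ min(T_σ(z − μ₁), T_σ(z − μ₂)) dz = (1 − Δ/(2σ))² if 0 ≤ Δ ≤ 2σ, and 0 if Δ ≥ 2σ. -/

import Mathlib

open MeasureTheory ENNReal

/-- Symmetric triangular probability density of half-width `σ`. -/
noncomputable def triDensity (σ z : ℝ) : ℝ :=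
  if |z| ≤ σ then (1 / σ) * (1 - |z| / σ) else 0

lemma triDensity_eq_max {σ : ℝ} (hσ : 0 < σ) (z : ℝ) :
    triDensity σ z = max 0 ((σ - |z|) / σ ^ 2) := by
  have key : 1 / σ * (1 - |z| / σ) = (σ - |z|) / σ ^ 2 := by field_simp
  unfold triDensity
  split_ifs with h
  · rw [key, max_eq_right (div_nonneg (by linarith) (by positivity))]
  · rw [max_eq_left (div_nonpos_of_nonpos_of_nonneg (by linarith) (by positivity))]

lemma max_abs_sub_abs_sub (a b z : ℝ) :
    max |z - a| |z - b| = |z - (a + b) / 2| + |a - b| / 2 := by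
  rcases abs_cases (z - a) with h | h <;> rcases abs_cases (z - b) with h' | h' <;>
    rcases abs_cases (z - (a + b) / 2) with h'' | h'' <;>
    rcases abs_cases (a - b) with k | k <;>
    rcases max_cases |z - a| |z - b| with l | l <;> linarith

/-- The minimum of two shifted triangular densities is a tent centred at the midpoint. -/
lemma ofReal_min_triDensity {σ : ℝ} (hσ : 0 < σ) (a b z : ℝ) :
    ENNReal.ofReal (min (triDensity σ (z - a)) (triDensity σ (z - b))) =
      ENNReal.ofReal ((σ - |a - b| / 2 - |z - (a + b) / 2|) / σ ^ 2) := by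
  rw [triDensity_eq_max hσ, triDensity_eq_max hσ, ← max_min_distrib_left,
    min_div_div_right (by positivity), min_sub_sub_left, max_abs_sub_abs_sub,
    ENNReal.ofReal_max, ENNReal.ofReal_zero, max_eq_right zero_le]
  congr 2
  ring

lemma lintegral_ofReal_sub_abs {h : ℝ} (hh : 0 ≤ h) :
    ∫⁻ x : ℝ, ENNReal.ofReal (h - |x|) = ENNReal.ofReal (h ^ 2) := by
  have hind : (fun x : ℝ => ENNReal.ofReal (h - |x|)) =
      (Set.Ioc (-h) h).indicator fun x => ENNReal.ofReal (h - |x|) := by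
    ext x
    by_cases hx : x ∈ Set.Ioc (-h) h
    · rw [Set.indicator_of_mem hx]
    · rw [Set.indicator_of_notMem hx, ENNReal.ofReal_eq_zero, sub_nonpos]
      by_contra! hlt
      exact hx ⟨(abs_lt.mp hlt).1, (abs_lt.mp hlt).2.le⟩
  have hcont : Continuous fun x : ℝ => h - |x| := by fun_prop
  rw [hind, lintegral_indicator measurableSet_Ioc, ← ofReal_integral_eq_lintegral_ofReal,
    ← intervalIntegral.integral_of_le (by linarith),
    ← intervalIntegral.integral_add_adjacent_intervals (b := 0)
      (hcont.intervalIntegrable _ _) (hcont.intervalIntegrable _ _)]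
  · have hneg : ∫ x in (-h)..0, (h - |x|) = ∫ x in (-h)..0, (h + x) := by
      refine intervalIntegral.integral_congr fun x hx => ?_
      rw [Set.uIcc_of_le (by linarith)] at hx
      simp [abs_of_nonpos hx.2]
    have hpos : ∫ x in (0)..h, (h - |x|) = ∫ x in (0)..h, (h - x) := by
      refine intervalIntegral.integral_congr fun x hx => ?_
      rw [Set.uIcc_of_le hh] at hx
      simp [abs_of_nonneg hx.1]
    rw [hneg, hpos, intervalIntegral.integral_add (by simp) (by simp),
      intervalIntegral.integral_sub (by simp) (by simp)]
    simp only [intervalIntegral.integral_const, integral_id, smul_eq_mul]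
    congr 1
    ring
  · exact (hcont.integrableOn_Icc (a := -h) (b := h)).mono_set Set.Ioc_subset_Icc_self
  · filter_upwards [ae_restrict_mem measurableSet_Ioc] with x hx
    exact sub_nonneg.mpr (abs_le.mpr ⟨hx.1.le, hx.2⟩)

/-- **Overlap coefficient of two shifted symmetric triangular densities.**
With `Δ = |μ₁ − μ₂|`, it equals `(1 − Δ/(2σ))²` when `0 ≤ Δ ≤ 2σ` and `0` when
`Δ ≥ 2σ`. -/
theorem triangular_overlap_coefficient (σ μ₁ μ₂ : ℝ) (hσ : 0 < σ) :
    (|μ₁ - μ₂| ≤ 2 * σ →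
      (∫⁻ z, ENNReal.ofReal (min (triDensity σ (z - μ₁)) (triDensity σ (z - μ₂)))) =
        ENNReal.ofReal ((1 - |μ₁ - μ₂| / (2 * σ)) ^ 2)) ∧
    (2 * σ ≤ |μ₁ - μ₂| →
      (∫⁻ z, ENNReal.ofReal (min (triDensity σ (z - μ₁)) (triDensity σ (z - μ₂)))) = 0) := by
  simp only [ofReal_min_triDensity hσ]
  refine ⟨fun hΔ => ?_, fun hΔ => ?_⟩
  · have hσ2 : 0 < σ ^ 2 := by positivity
    rw [lintegral_sub_right_eq_self
      (fun x => ENNReal.ofReal ((σ - |μ₁ - μ₂| / 2 - |x|) / σ ^ 2))]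
    simp only [div_eq_mul_inv _ (σ ^ 2), ENNReal.ofReal_mul' (inv_nonneg.mpr hσ2.le)]
    rw [lintegral_mul_const _ (by fun_prop), lintegral_ofReal_sub_abs (by linarith),
      ← ENNReal.ofReal_mul' (inv_nonneg.mpr hσ2.le)]
    congr 1
    field_simp
  · refine (lintegral_congr fun z => ?_).trans lintegral_zero
    rw [ENNReal.ofReal_eq_zero]
    refine div_nonpos_of_nonpos_of_nonneg ?_ (by positivity)
    linarith [abs_nonneg (z - (μ₁ + μ₂) / 2)]
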